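/- Let Λ ⊂ ℝ² be a lattice. Then Θ_{1,1;Λ} vanishes identically on the upper half plane if and only if there exist a real number c > 0 and an orthogonal transformation φ ∈ O(2) such that φ(c·Λ) is either the square lattice ℤ² (the Gaussian integers) or the hexagonal lattice spanned by (1,0) and (1/2, √3/2) (the Eisenstein integers). -/

import Mathlib

open scoped BigOperators

noncomputable section

/-- The standard Euclidean inner product on `ℝ²`. -/
def ip (v w : Fin 2 → ℝ) : ℝ := ∑ i, v i * w i

/-- The squared Euclidean norm on `ℝ²`. -/
def nsq (v : Fin 2 → ℝ) : ℝ := ∑ i, v i ^ 2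

/-- `q^t = exp(2 π i t τ)`. -/
def eq2 (t : ℝ) (τ : ℂ) : ℂ := Complex.exp (2 * Real.pi * Complex.I * t * τ)

/-- The lattice vector `Σᵢ cᵢ bᵢ` attached to the integer coefficient vector `c`. -/
def LV (b : Fin 2 → Fin 2 → ℝ) (c : Fin 2 → ℤ) : Fin 2 → ℝ :=
  ∑ i, (c i : ℝ) • b i

/-- The square lattice `ℤ² ⊂ ℝ²` (the Gaussian integers). -/
def squareLattice : Set (Fin 2 → ℝ) :=
  {x | ∃ c : Fin 2 → ℤ, x = fun i => (c i : ℝ)}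

/-- The hexagonal lattice spanned by `(1,0)` and `(1/2, √3/2)` (the Eisenstein
integers). -/
def hexLattice : Set (Fin 2 → ℝ) :=
  {x | ∃ c : Fin 2 → ℤ,
    x = (c 0 : ℝ) • (![1, 0] : Fin 2 → ℝ) + (c 1 : ℝ) • (![1 / 2, Real.sqrt 3 / 2] : Fin 2 → ℝ)}

/-! ### Bilinear algebra of the lattice map -/

lemma nsq_eq_ip (v : Fin 2 → ℝ) : nsq v = ip v v := by
  simp only [nsq, ip, Fin.sum_univ_two]; ring

lemma ip_LV (b : Fin 2 → Fin 2 → ℝ) (c d : Fin 2 → ℤ) :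
    ip (LV b c) (LV b d) =
      nsq (b 0) * (c 0 * d 0) + ip (b 0) (b 1) * (c 0 * d 1 + c 1 * d 0)
        + nsq (b 1) * (c 1 * d 1) := by
  simp only [nsq, ip, LV, Fin.sum_univ_two, Pi.add_apply, Pi.smul_apply, smul_eq_mul]; ring

lemma nsq_LV (b : Fin 2 → Fin 2 → ℝ) (c : Fin 2 → ℤ) :
    nsq (LV b c) = nsq (b 0) * (c 0 : ℝ) ^ 2 + 2 * ip (b 0) (b 1) * (c 0 * c 1)
      + nsq (b 1) * (c 1 : ℝ) ^ 2 := by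
  rw [nsq_eq_ip, ip_LV]; ring

lemma nsq_nonneg (v : Fin 2 → ℝ) : 0 ≤ nsq v :=
  Finset.sum_nonneg fun _ _ => sq_nonneg _

lemma ip_sq_le (v w : Fin 2 → ℝ) : ip v w ^ 2 ≤ nsq v * nsq w := by
  simp only [nsq, ip, Fin.sum_univ_two]
  nlinarith [sq_nonneg (v 0 * w 1 - v 1 * w 0)]

/-- The Gram determinant of a pair of vectors. -/
def gramDet (b : Fin 2 → Fin 2 → ℝ) : ℝ := nsq (b 0) * nsq (b 1) - ip (b 0) (b 1) ^ 2

lemma gramDet_eq (b : Fin 2 → Fin 2 → ℝ) :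
    gramDet b = (b 0 0 * b 1 1 - b 0 1 * b 1 0) ^ 2 := by
  simp only [gramDet, nsq, ip, Fin.sum_univ_two]; ring

lemma gramDet_pos_of_linearIndependent {b : Fin 2 → Fin 2 → ℝ} (hb : LinearIndependent ℝ b) :
    0 < gramDet b := by
  have h : IsUnit (Matrix.of b) := Matrix.linearIndependent_rows_iff_isUnit.1 hb
  rw [Matrix.isUnit_iff_isUnit_det, Matrix.det_fin_two, isUnit_iff_ne_zero] at h
  rw [gramDet_eq]
  exact sq_pos_iff.2 h

lemma nsq_add_pos {b : Fin 2 → Fin 2 → ℝ} (hb : 0 < gramDet b) :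
    0 < nsq (b 0) + nsq (b 1) := by
  have h0 := nsq_nonneg (b 0)
  have h1 := nsq_nonneg (b 1)
  unfold gramDet at hb
  by_contra h
  have e0 : nsq (b 0) = 0 := by linarith
  rw [e0] at hb
  nlinarith [sq_nonneg (ip (b 0) (b 1))]

lemma exists_pos_mul_le_nsq_LV {b : Fin 2 → Fin 2 → ℝ} (hb : 0 < gramDet b) :
    ∃ κ : ℝ, 0 < κ ∧ ∀ c, κ * ((c 0 : ℝ) ^ 2 + (c 1 : ℝ) ^ 2) ≤ nsq (LV b c) := by
  have ht := nsq_add_pos hb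
  refine ⟨gramDet b / (nsq (b 0) + nsq (b 1)), div_pos hb ht, fun c => ?_⟩
  rw [div_mul_eq_mul_div, div_le_iff₀ ht, nsq_LV, gramDet]
  nlinarith [sq_nonneg (nsq (b 0) * c 0 + ip (b 0) (b 1) * c 1),
    sq_nonneg (ip (b 0) (b 1) * c 0 + nsq (b 1) * c 1)]

lemma sq_add_sq_pos_of_ne_zero {c : Fin 2 → ℤ} (hc : c ≠ 0) : 0 < c 0 ^ 2 + c 1 ^ 2 := by
  by_contra h
  apply hc
  have h0 : c 0 = 0 := by nlinarith [sq_nonneg (c 0), sq_nonneg (c 1)]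
  have h1 : c 1 = 0 := by nlinarith [sq_nonneg (c 0), sq_nonneg (c 1)]
  ext i; fin_cases i <;> simpa

lemma nsq_LV_pos {b : Fin 2 → Fin 2 → ℝ} (hb : 0 < gramDet b) {c : Fin 2 → ℤ} (hc : c ≠ 0) :
    0 < nsq (LV b c) := by
  obtain ⟨κ, hκ, h⟩ := exists_pos_mul_le_nsq_LV hb
  refine lt_of_lt_of_le (mul_pos hκ ?_) (h c)
  exact_mod_cast sq_add_sq_pos_of_ne_zero hc

lemma LV_injective {b : Fin 2 → Fin 2 → ℝ} (hb : 0 < gramDet b) :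
    Function.Injective (LV b) := by
  intro c d h
  by_contra hne
  have h2 := nsq_LV_pos hb (sub_ne_zero.2 hne)
  have h3 : LV b (c - d) = LV b c - LV b d := by
    ext i
    simp only [LV, Fin.sum_univ_two, Pi.add_apply, Pi.smul_apply, Pi.sub_apply, smul_eq_mul,
      Int.cast_sub]
    ring
  rw [h3, h, sub_self] at h2
  simp [nsq] at h2

/-! ### The lattice as a set, and change of basis -/

/-- The lattice generated by two vectors. -/
def latticeSet (b : Fin 2 → Fin 2 → ℝ) : Set (Fin 2 → ℝ) := {x | ∃ c : Fin 2 → ℤ, x = LV b c}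

/-- The summand of the theta series `Θ_{1,1;Λ}` for the lattice with basis `b`. -/
def theta11Term (b : Fin 2 → Fin 2 → ℝ) (τ : ℂ) (cd : (Fin 2 → ℤ) × (Fin 2 → ℤ)) : ℂ :=
  (((ip (LV b cd.1) (LV b cd.2)) ^ 2
      - (1 / 2 : ℝ) * nsq (LV b cd.1) * nsq (LV b cd.2) : ℝ) : ℂ) *
    eq2 (nsq (LV b cd.1) + nsq (LV b cd.2)) τ

/-- The theta series `Θ_{1,1;Λ}` for the lattice with basis `b`. -/
def theta11 (b : Fin 2 → Fin 2 → ℝ) (τ : ℂ) : ℂ :=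
  ∑' cd : (Fin 2 → ℤ) × (Fin 2 → ℤ), theta11Term b τ cd

lemma exists_equiv_of_latticeSet_eq {b b' : Fin 2 → Fin 2 → ℝ} (hb : 0 < gramDet b)
    (hb' : 0 < gramDet b') (h : latticeSet b = latticeSet b') :
    ∃ e : (Fin 2 → ℤ) ≃ (Fin 2 → ℤ), ∀ c, LV b (e c) = LV b' c := by
  have h1 : ∀ c, ∃ d, LV b d = LV b' c := fun c => by
    have : LV b' c ∈ latticeSet b := h ▸ ⟨c, rfl⟩
    obtain ⟨d, hd⟩ := this
    exact ⟨d, hd.symm⟩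
  have h2 : ∀ c, ∃ d, LV b' d = LV b c := fun c => by
    have : LV b c ∈ latticeSet b' := h ▸ ⟨c, rfl⟩
    obtain ⟨d, hd⟩ := this
    exact ⟨d, hd.symm⟩
  choose f hf using h1
  choose g hg using h2
  exact ⟨⟨f, g, fun c => LV_injective hb' (by rw [hg, hf]),
    fun c => LV_injective hb (by rw [hf, hg])⟩, hf⟩

lemma theta11_congr {b b' : Fin 2 → Fin 2 → ℝ} (hb : 0 < gramDet b)
    (hb' : 0 < gramDet b') (h : latticeSet b = latticeSet b') (τ : ℂ) :
    theta11 b τ = theta11 b' τ := by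
  obtain ⟨e, he⟩ := exists_equiv_of_latticeSet_eq hb hb' h
  unfold theta11
  rw [← (e.prodCongr e).tsum_eq]
  simp only [theta11Term, Equiv.prodCongr_apply, Prod.map_fst, Prod.map_snd, he]

/-! ### Vanishing for the square and hexagonal lattices -/

lemma theta11_eq_zero_of_gram_square {b : Fin 2 → Fin 2 → ℝ} (h1 : nsq (b 1) = nsq (b 0))
    (h2 : ip (b 0) (b 1) = 0) (τ : ℂ) : theta11 b τ = 0 := by
  obtain ⟨e, he0, he1⟩ : ∃ e : (Fin 2 → ℤ) ≃ (Fin 2 → ℤ),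
      (∀ c, e c 0 = -c 1) ∧ ∀ c, e c 1 = c 0 :=
    ⟨{ toFun := fun c => ![-c 1, c 0]
       invFun := fun c => ![c 1, -c 0]
       left_inv := fun c => by ext i; fin_cases i <;> simp
       right_inv := fun c => by ext i; fin_cases i <;> simp }, fun _ => rfl, fun _ => rfl⟩
  have key : theta11 b τ = -theta11 b τ := by
    conv_lhs => rw [theta11, ← (e.prodCongr (Equiv.refl _)).tsum_eq]
    rw [theta11, ← tsum_neg]
    refine tsum_congr fun cd => ?_
    have hn : nsq (LV b (e cd.1)) = nsq (LV b cd.1) := by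
      simp only [nsq_LV, h1, h2, he0, he1]
      push_cast; ring
    have hc : ip (LV b (e cd.1)) (LV b cd.2) ^ 2
          - (1 / 2 : ℝ) * nsq (LV b cd.1) * nsq (LV b cd.2)
        = -(ip (LV b cd.1) (LV b cd.2) ^ 2
          - (1 / 2 : ℝ) * nsq (LV b cd.1) * nsq (LV b cd.2)) := by
      simp only [ip_LV, nsq_LV, h1, h2, he0, he1]
      push_cast; ring
    simp only [theta11Term, Equiv.prodCongr_apply, Prod.map_fst, Prod.map_snd,
      Equiv.refl_apply, hn, hc]
    push_cast; ring
  exact self_eq_neg.1 key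

lemma tsum_eq_zero_of_add_comp_equiv {α : Type*} {f : α → ℂ} (E : α ≃ α)
    (h : ∀ x, f x + f (E x) + f (E (E x)) = 0) : ∑' x, f x = 0 := by
  by_cases hs : Summable f
  swap
  · exact tsum_eq_zero_of_not_summable hs
  have hs1 : Summable fun x => f (E x) := E.summable_iff.2 hs
  have hs2 : Summable fun x => f (E (E x)) := E.summable_iff.2 hs1
  have t1 : ∑' x, f (E x) = ∑' x, f x := E.tsum_eq f
  have t2 : ∑' x, f (E (E x)) = ∑' x, f x := by rw [E.tsum_eq fun x => f (E x), t1]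
  have t3 := (hs.add hs1).tsum_add hs2
  rw [hs.tsum_add hs1, t1, t2, tsum_congr h, tsum_zero] at t3
  linear_combination -t3 / 3

lemma sum_coeff_hexagonal_rotation {b : Fin 2 → Fin 2 → ℝ} (h1 : nsq (b 1) = nsq (b 0))
    (h2 : ip (b 0) (b 1) = nsq (b 0) / 2) {c c' c'' : Fin 2 → ℤ} (h0' : c' 0 = -c 1)
    (h1' : c' 1 = c 0 + c 1) (h0'' : c'' 0 = -c' 1) (h1'' : c'' 1 = c' 0 + c' 1)
    (d : Fin 2 → ℤ) :
    (ip (LV b c) (LV b d) ^ 2 - (1 / 2 : ℝ) * nsq (LV b c) * nsq (LV b d))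
      + (ip (LV b c') (LV b d) ^ 2 - (1 / 2 : ℝ) * nsq (LV b c) * nsq (LV b d))
      + (ip (LV b c'') (LV b d) ^ 2 - (1 / 2 : ℝ) * nsq (LV b c) * nsq (LV b d)) = 0 := by
  simp only [ip_LV, nsq_LV, h1, h2, h0'', h1'', h0', h1']
  push_cast
  ring

lemma theta11_eq_zero_of_gram_hexagonal {b : Fin 2 → Fin 2 → ℝ} (h1 : nsq (b 1) = nsq (b 0))
    (h2 : ip (b 0) (b 1) = nsq (b 0) / 2) (τ : ℂ) : theta11 b τ = 0 := by
  obtain ⟨e, he0, he1⟩ : ∃ e : (Fin 2 → ℤ) ≃ (Fin 2 → ℤ),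
      (∀ c, e c 0 = -c 1) ∧ ∀ c, e c 1 = c 0 + c 1 :=
    ⟨{ toFun := fun c => ![-c 1, c 0 + c 1]
       invFun := fun c => ![c 0 + c 1, -c 0]
       left_inv := fun c => by ext i; fin_cases i <;> simp
       right_inv := fun c => by ext i; fin_cases i <;> simp }, fun _ => rfl, fun _ => rfl⟩
  have hn : ∀ c, nsq (LV b (e c)) = nsq (LV b c) := fun c => by
    simp only [nsq_LV, h1, h2, he0, he1]
    push_cast; ring
  refine tsum_eq_zero_of_add_comp_equiv (e.prodCongr (Equiv.refl _)) fun cd => ?_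
  have hc := sum_coeff_hexagonal_rotation h1 h2 (he0 cd.1) (he1 cd.1) (he0 (e cd.1))
    (he1 (e cd.1)) cd.2
  simp only [theta11Term, Equiv.prodCongr_apply, Prod.map_fst, Prod.map_snd,
    Equiv.refl_apply, hn]
  rw [← add_mul, ← add_mul, ← Complex.ofReal_add, ← Complex.ofReal_add, hc,
    Complex.ofReal_zero, zero_mul]

/-! ### Reduced bases -/

lemma exists_nsq_LV_minimal {b : Fin 2 → Fin 2 → ℝ} (hb : 0 < gramDet b)
    {T : Set (Fin 2 → ℤ)} (hT : T.Nonempty) :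
    ∃ c ∈ T, ∀ d ∈ T, nsq (LV b c) ≤ nsq (LV b d) := by
  obtain ⟨κ, hκ, h⟩ := exists_pos_mul_le_nsq_LV hb
  obtain ⟨a, ha⟩ := hT
  obtain ⟨N, hN⟩ := exists_nat_gt (nsq (LV b a) / κ)
  rw [div_lt_iff₀ hκ] at hN
  have hfin : (T ∩ {c | nsq (LV b c) ≤ nsq (LV b a)}).Finite := by
    refine (Set.finite_Icc (fun _ => -(N : ℤ)) (fun _ => (N : ℤ))).subset ?_
    rintro c ⟨-, hc⟩
    have h3 : (c 0 : ℝ) ^ 2 + (c 1 : ℝ) ^ 2 < N := by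
      have := (h c).trans hc
      by_contra hcon
      nlinarith
    have h4 : c 0 ^ 2 + c 1 ^ 2 < (N : ℤ) := by exact_mod_cast h3
    rw [Set.mem_Icc, Pi.le_def, Pi.le_def]
    constructor <;> intro i <;> fin_cases i <;> simp <;>
      nlinarith [sq_nonneg (c 0), sq_nonneg (c 1)]
  obtain ⟨c, hc, hmin⟩ := Set.exists_min_image _ (fun c => nsq (LV b c)) hfin
    ⟨a, ha, le_refl (nsq (LV b a))⟩
  refine ⟨c, hc.1, fun d hd => ?_⟩
  rcases le_total (nsq (LV b d)) (nsq (LV b a)) with h5 | h5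
  · exact hmin d ⟨hd, h5⟩
  · exact le_trans hc.2 h5

lemma LV_pair (b : Fin 2 → Fin 2 → ℝ) (c d s : Fin 2 → ℤ) :
    LV ![LV b c, LV b d] s = LV b (s 0 • c + s 1 • d) := by
  ext i
  simp only [LV, Fin.sum_univ_two, Pi.add_apply, Pi.smul_apply, smul_eq_mul,
    Matrix.cons_val_zero, Matrix.cons_val_one, Int.cast_add, Int.cast_mul]
  ring

lemma gramDet_pair (b : Fin 2 → Fin 2 → ℝ) (c d : Fin 2 → ℤ) :
    gramDet ![LV b c, LV b d] = ((c 0 * d 1 - c 1 * d 0 : ℤ) : ℝ) ^ 2 * gramDet b := by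
  simp only [gramDet, Matrix.cons_val_zero, Matrix.cons_val_one, ip_LV, nsq_LV]
  push_cast; ring

lemma reduced_form_lt {A B C p q : ℝ} (hA : 0 < A) (hAC : A ≤ C) (hB : 0 ≤ B)
    (h2B : 2 * B ≤ A) (hp : |p| ≤ 1 / 2) (hq : |q| ≤ 1 / 2) :
    p ^ 2 * A + 2 * (p * q) * B + q ^ 2 * C < C := by
  have hp2 : p ^ 2 ≤ 1 / 4 := (sq_le_sq' (abs_le.1 hp).1 (abs_le.1 hp).2).trans (by norm_num)
  have hq2 : q ^ 2 ≤ 1 / 4 := (sq_le_sq' (abs_le.1 hq).1 (abs_le.1 hq).2).trans (by norm_num)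
  have hpq : p * q ≤ 1 / 4 := by linarith [two_mul_le_add_sq p q]
  linarith [mul_le_mul_of_nonneg_right hp2 hA.le, mul_le_mul_of_nonneg_right hpq hB,
    mul_le_mul_of_nonneg_right hq2 (hA.le.trans hAC)]

lemma exists_LV_pair_eq_of_minimal {b : Fin 2 → Fin 2 → ℝ} {c d : Fin 2 → ℤ}
    (hA : 0 < nsq (LV b c)) (hcmin : ∀ e : Fin 2 → ℤ, e ≠ 0 → nsq (LV b c) ≤ nsq (LV b e))
    (hD : c 0 * d 1 - c 1 * d 0 ≠ 0)
    (hdmin : ∀ e : Fin 2 → ℤ, c 0 * e 1 - c 1 * e 0 ≠ 0 → nsq (LV b d) ≤ nsq (LV b e))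
    (hAC : nsq (LV b c) ≤ nsq (LV b d)) (hB : 0 ≤ ip (LV b c) (LV b d))
    (h2B : 2 * ip (LV b c) (LV b d) ≤ nsq (LV b c)) (e : Fin 2 → ℤ) :
    ∃ s : Fin 2 → ℤ, LV b e = LV ![LV b c, LV b d] s := by
  have hDR : (c 0 * d 1 - c 1 * d 0 : ℝ) ≠ 0 := by exact_mod_cast hD
  set x : ℝ := (e 0 * d 1 - e 1 * d 0) / (c 0 * d 1 - c 1 * d 0) with hx
  set y : ℝ := (c 0 * e 1 - c 1 * e 0) / (c 0 * d 1 - c 1 * d 0) with hy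
  set p := x - round x with hp
  set q := y - round y with hq
  have hpb : |p| ≤ 1 / 2 := abs_sub_round x
  have hqb : |q| ≤ 1 / 2 := abs_sub_round y
  set e' : Fin 2 → ℤ := e - (round x • c + round y • d) with he'
  have hx0 : x * (c 0 * d 1 - c 1 * d 0) = e 0 * d 1 - e 1 * d 0 := div_mul_cancel₀ _ hDR
  have hy0 : y * (c 0 * d 1 - c 1 * d 0) = c 0 * e 1 - c 1 * e 0 := div_mul_cancel₀ _ hDR
  have e0 : (e' 0 : ℝ) = p * c 0 + q * d 0 := by
    apply mul_right_cancel₀ hDR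
    simp only [he', Pi.sub_apply, Pi.add_apply, Pi.smul_apply, smul_eq_mul, hp, hq]
    push_cast
    linear_combination -(c 0 : ℝ) * hx0 - (d 0 : ℝ) * hy0
  have e1 : (e' 1 : ℝ) = p * c 1 + q * d 1 := by
    apply mul_right_cancel₀ hDR
    simp only [he', Pi.sub_apply, Pi.add_apply, Pi.smul_apply, smul_eq_mul, hp, hq]
    push_cast
    linear_combination -(c 1 : ℝ) * hx0 - (d 1 : ℝ) * hy0
  have hN : nsq (LV b e') = p ^ 2 * nsq (LV b c) + 2 * (p * q) * ip (LV b c) (LV b d)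
      + q ^ 2 * nsq (LV b d) := by
    rw [nsq_LV b e', e0, e1]
    simp only [nsq_LV, ip_LV]; ring
  have hdet : ((c 0 * e' 1 - c 1 * e' 0 : ℤ) : ℝ) = q * (c 0 * d 1 - c 1 * d 0) := by
    push_cast; rw [e0, e1]; ring
  have hq0 : q = 0 := by
    by_contra hne
    have h1 := hdmin e' fun h => by
      rw [h, Int.cast_zero] at hdet
      exact mul_ne_zero hne hDR hdet.symm
    rw [hN] at h1
    exact h1.not_gt (reduced_form_lt hA hAC hB h2B hpb hqb)
  have hz : e' = 0 := by
    by_contra hne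
    have h1 := hcmin e' hne
    have h2 := reduced_form_lt hA le_rfl hB h2B hpb (q := 0) (by norm_num)
    rw [hN, hq0] at h1
    simp only [mul_zero, zero_mul, ne_eq, OfNat.ofNat_ne_zero, not_false_eq_true, zero_pow,
      add_zero] at h1 h2
    exact h1.not_gt h2
  refine ⟨![round x, round y], ?_⟩
  rw [LV_pair]
  congr 1
  simpa [he', sub_eq_zero] using hz

lemma exists_reduced_basis {b : Fin 2 → Fin 2 → ℝ} (hb : 0 < gramDet b) :
    ∃ b', 0 < gramDet b' ∧ latticeSet b' = latticeSet b ∧ 0 < nsq (b' 0) ∧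
      nsq (b' 0) ≤ nsq (b' 1) ∧ 0 ≤ ip (b' 0) (b' 1) ∧ 2 * ip (b' 0) (b' 1) ≤ nsq (b' 0) := by
  obtain ⟨c, hc, hcmin⟩ := exists_nsq_LV_minimal hb (T := {c | c ≠ 0})
    ⟨![1, 0], fun h => by simpa using congrFun h 0⟩
  have hA := nsq_LV_pos hb hc
  obtain ⟨d, hD, hdmin, hB⟩ : ∃ d : Fin 2 → ℤ, c 0 * d 1 - c 1 * d 0 ≠ 0 ∧
      (∀ e : Fin 2 → ℤ, c 0 * e 1 - c 1 * e 0 ≠ 0 → nsq (LV b d) ≤ nsq (LV b e)) ∧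
      0 ≤ ip (LV b c) (LV b d) := by
    obtain ⟨d, hd, hdmin⟩ := exists_nsq_LV_minimal hb
      (T := {d | c 0 * d 1 - c 1 * d 0 ≠ 0})
      ⟨![-c 1, c 0], by
        have := sq_add_sq_pos_of_ne_zero hc
        simp only [Set.mem_ofPred_eq, Matrix.cons_val_zero, Matrix.cons_val_one]
        intro h
        nlinarith⟩
    rcases le_total 0 (ip (LV b c) (LV b d)) with h | h
    · exact ⟨d, hd, hdmin, h⟩
    · refine ⟨-d, fun h' => hd ?_, fun e he => ?_, ?_⟩
      · simp only [Pi.neg_apply] at h'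
        linarith
      · refine le_trans (le_of_eq ?_) (hdmin e he)
        simp only [nsq_LV, Pi.neg_apply, Int.cast_neg]; ring
      · have : ip (LV b c) (LV b (-d)) = -ip (LV b c) (LV b d) := by
          simp only [ip_LV, Pi.neg_apply, Int.cast_neg]; ring
        rw [this]; linarith
  have hAC : nsq (LV b c) ≤ nsq (LV b d) := hcmin d fun h => hD (by simp [h])
  have h2B : 2 * ip (LV b c) (LV b d) ≤ nsq (LV b c) := by
    have h := hdmin (d - c) (by
      simp only [Pi.sub_apply]; intro h; apply hD; linarith)
    have h' : nsq (LV b (d - c)) =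
        nsq (LV b d) - 2 * ip (LV b c) (LV b d) + nsq (LV b c) := by
      simp only [nsq_LV, ip_LV, Pi.sub_apply, Int.cast_sub]; ring
    linarith
  have hG : 0 < gramDet ![LV b c, LV b d] := by
    rw [gramDet_pair]
    exact mul_pos (sq_pos_iff.2 (Int.cast_ne_zero.2 hD)) hb
  refine ⟨![LV b c, LV b d], hG, ?_, hA, hAC, hB, h2B⟩
  ext x
  constructor
  · rintro ⟨s, rfl⟩
    exact ⟨_, LV_pair b c d s⟩
  · rintro ⟨e, rfl⟩
    exact exists_LV_pair_eq_of_minimal hA hcmin hD hdmin hAC hB h2B e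

/-! ### The leading coefficient of the theta series -/

lemma summable_exp_neg_mul_int_sq {κ : ℝ} (hκ : 0 < κ) :
    Summable fun n : ℤ => Real.exp (-κ * (n : ℝ) ^ 2) := by
  have h : Summable fun n : ℕ => Real.exp (-κ * (n : ℝ) ^ 2) :=
    Real.summable_exp_nat_mul_of_ge (neg_lt_zero.2 hκ) fun i => by
      exact_mod_cast Nat.le_self_pow two_ne_zero i
  refine Summable.of_nat_of_neg (by simpa using h) (by simpa using h)

lemma summable_nsq_mul_exp {b : Fin 2 → Fin 2 → ℝ} (hb : 0 < gramDet b) :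
    Summable fun c => nsq (LV b c) * Real.exp (-(2 * Real.pi * nsq (LV b c))) := by
  obtain ⟨κ, hκ, h⟩ := exists_pos_mul_le_nsq_LV hb
  have hs := (summable_exp_neg_mul_int_sq hκ).mul_of_nonneg (summable_exp_neg_mul_int_sq hκ)
    (fun _ => (Real.exp_pos _).le) (fun _ => (Real.exp_pos _).le)
  rw [← (finTwoArrowEquiv ℤ).summable_iff] at hs
  refine Summable.of_nonneg_of_le (fun c => mul_nonneg (nsq_nonneg _) (Real.exp_pos _).le)
    (fun c => ?_) hs
  have hx := nsq_nonneg (LV b c)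
  simp only [Function.comp_apply, finTwoArrowEquiv_apply, ← Real.exp_add]
  calc nsq (LV b c) * Real.exp (-(2 * Real.pi * nsq (LV b c)))
      ≤ Real.exp (nsq (LV b c)) * Real.exp (-(2 * Real.pi * nsq (LV b c))) := by
        gcongr
        linarith [Real.add_one_le_exp (nsq (LV b c))]
    _ = Real.exp (nsq (LV b c) - 2 * Real.pi * nsq (LV b c)) := by
        rw [← Real.exp_add]; rfl
    _ ≤ _ := by
        apply Real.exp_le_exp.2
        change _ ≤ -κ * (c 0 : ℝ) ^ 2 + -κ * (c 1 : ℝ) ^ 2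
        nlinarith [h c, Real.pi_gt_three]

open Filter Topology in
lemma tsum_leading_eq_zero {b : Fin 2 → Fin 2 → ℝ} (hb : 0 < gramDet b) {m : ℝ}
    (hm : ∀ c ≠ 0, m ≤ nsq (LV b c)) (hθ : ∀ τ : ℂ, 0 < τ.im → theta11 b τ = 0) :
    ∑' cd : (Fin 2 → ℤ) × (Fin 2 → ℤ),
      (if nsq (LV b cd.1) + nsq (LV b cd.2) = 2 * m then
        ip (LV b cd.1) (LV b cd.2) ^ 2 - (1 / 2 : ℝ) * nsq (LV b cd.1) * nsq (LV b cd.2)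
      else 0) = 0 := by
  set a : (Fin 2 → ℤ) × (Fin 2 → ℤ) → ℝ := fun cd =>
    ip (LV b cd.1) (LV b cd.2) ^ 2 - (1 / 2 : ℝ) * nsq (LV b cd.1) * nsq (LV b cd.2) with ha
  set t : (Fin 2 → ℤ) × (Fin 2 → ℤ) → ℝ := fun cd =>
    nsq (LV b cd.1) + nsq (LV b cd.2) - 2 * m with ht
  have habs : ∀ cd, |a cd| ≤ nsq (LV b cd.1) * nsq (LV b cd.2) := fun cd => by
    have h1 := ip_sq_le (LV b cd.1) (LV b cd.2)
    have h2 := mul_nonneg (nsq_nonneg (LV b cd.1)) (nsq_nonneg (LV b cd.2))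
    rw [abs_le]
    constructor <;> simp only [ha] <;> nlinarith [sq_nonneg (ip (LV b cd.1) (LV b cd.2))]
  have ha0 : ∀ cd, a cd ≠ 0 → 0 ≤ t cd := fun cd h => by
    have hLV0 : LV b 0 = 0 := by ext i; simp [LV]
    have h1 : cd.1 ≠ 0 := fun h' => h (by simp [ha, h', hLV0, ip, nsq])
    have h2 : cd.2 ≠ 0 := fun h' => h (by simp [ha, h', hLV0, ip, nsq])
    have := hm _ h1
    have := hm _ h2
    simp only [ht]; linarith
  have hzero : ∀ y : ℝ, 0 < y → ∑' cd, a cd * Real.exp (-(2 * Real.pi * y) * t cd) = 0 := by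
    intro y hy
    have h1 := hθ (y * Complex.I) (by simpa using hy)
    have h2 : theta11 b (y * Complex.I) =
        ((∑' cd, a cd * Real.exp (-(2 * Real.pi * y) * (t cd + 2 * m)) : ℝ) : ℂ) := by
      rw [theta11, Complex.ofReal_tsum]
      refine tsum_congr fun cd => ?_
      rw [theta11Term, Complex.ofReal_mul, Complex.ofReal_exp, eq2]
      congr 2
      simp only [ht]
      push_cast
      linear_combination (2 * Real.pi * (nsq (LV b cd.1) + nsq (LV b cd.2)) * y : ℂ)
        * Complex.I_mul_I
    rw [h2, Complex.ofReal_eq_zero] at h1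
    have h3 : ∀ cd, a cd * Real.exp (-(2 * Real.pi * y) * t cd) =
        Real.exp (2 * Real.pi * y * (2 * m)) *
          (a cd * Real.exp (-(2 * Real.pi * y) * (t cd + 2 * m))) := fun cd => by
      rw [mul_left_comm, ← Real.exp_add]
      congr 2; ring
    rw [tsum_congr h3, tsum_mul_left, h1, mul_zero]
  have hbound : Summable fun cd : (Fin 2 → ℤ) × (Fin 2 → ℤ) =>
      |a cd| * Real.exp (-(2 * Real.pi) * t cd) := by
    have hs := (summable_nsq_mul_exp hb).mul_of_nonneg (summable_nsq_mul_exp hb)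
      (fun c => mul_nonneg (nsq_nonneg _) (Real.exp_pos _).le)
      (fun c => mul_nonneg (nsq_nonneg _) (Real.exp_pos _).le)
    refine Summable.of_nonneg_of_le (fun cd => by positivity) (fun cd => ?_)
      (hs.mul_left (Real.exp (2 * Real.pi * (2 * m))))
    calc |a cd| * Real.exp (-(2 * Real.pi) * t cd)
        ≤ nsq (LV b cd.1) * nsq (LV b cd.2) * Real.exp (-(2 * Real.pi) * t cd) := by
          gcongr; exact habs cd
      _ = _ := by
          have : -(2 * Real.pi) * t cd = 2 * Real.pi * (2 * m)
              + (-(2 * Real.pi * nsq (LV b cd.1)) + -(2 * Real.pi * nsq (LV b cd.2))) := by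
            simp only [ht]; ring
          rw [this, Real.exp_add, Real.exp_add]; ring
  have hlim := tendsto_tsum_of_dominated_convergence (𝓕 := (atTop : Filter ℝ))
    (f := fun y cd => a cd * Real.exp (-(2 * Real.pi * y) * t cd))
    (g := fun cd => if nsq (LV b cd.1) + nsq (LV b cd.2) = 2 * m then a cd else 0)
    hbound (fun cd => ?_) ?_
  · refine tendsto_nhds_unique hlim (tendsto_const_nhds.congr' ?_)
    filter_upwards [eventually_gt_atTop 0] with y hy
    exact (hzero y hy).symm
  · by_cases h : a cd = 0
    · simp [h]
    rcases (ha0 cd h).eq_or_lt with h0 | h0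
    · have h' : nsq (LV b cd.1) + nsq (LV b cd.2) = 2 * m := by
        simp only [ht] at h0; linarith
      simp [← h0, h']
    · have h' : nsq (LV b cd.1) + nsq (LV b cd.2) ≠ 2 * m := by
        simp only [ht] at h0; intro h; linarith
      rw [if_neg h', ← mul_zero (a cd)]
      refine Tendsto.const_mul _ (Real.tendsto_exp_atBot.comp ?_)
      have h3 : (fun y : ℝ => -(2 * Real.pi * y) * t cd) =
          fun y => -((2 * Real.pi * t cd) * y) := by ext y; ring
      rw [h3]
      exact tendsto_neg_atTop_atBot.comp (tendsto_id.const_mul_atTop (by positivity))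
  · filter_upwards [eventually_ge_atTop 1] with y hy cd
    rw [norm_mul, Real.norm_eq_abs, Real.norm_eq_abs, Real.abs_exp]
    by_cases h : a cd = 0
    · simp [h]
    gcongr ?_ * Real.exp ?_
    have := ha0 cd h
    have := mul_nonneg (mul_nonneg Real.pi_pos.le this) (sub_nonneg.2 hy)
    linarith

lemma sum_minimal_eq_zero {b : Fin 2 → Fin 2 → ℝ} (hb : 0 < gramDet b) {m : ℝ}
    (hm : ∀ c ≠ 0, m ≤ nsq (LV b c)) (hθ : ∀ τ : ℂ, 0 < τ.im → theta11 b τ = 0)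
    {F : Finset (Fin 2 → ℤ)} (hF : ∀ c, c ∈ F ↔ nsq (LV b c) = m) :
    ∑ c ∈ F, ∑ d ∈ F,
      (ip (LV b c) (LV b d) ^ 2 - (1 / 2 : ℝ) * nsq (LV b c) * nsq (LV b d)) = 0 := by
  rw [← Finset.sum_product', ← tsum_leading_eq_zero hb hm hθ]
  rw [tsum_eq_sum (s := F ×ˢ F)]
  · refine Finset.sum_congr rfl fun cd hcd => ?_
    rw [Finset.mem_product, hF, hF] at hcd
    rw [if_pos (by linarith)]
  · intro cd hcd
    rw [Finset.mem_product, hF, hF, not_and_or] at hcd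
    have hLV0 : LV b 0 = 0 := by ext i; simp [LV]
    by_cases h1 : cd.1 = 0
    · simp [h1, hLV0, ip, nsq]
    by_cases h2 : cd.2 = 0
    · simp [h2, hLV0, ip, nsq]
    have h1 := hm _ h1
    have h2 := hm _ h2
    refine if_neg fun h => ?_
    rcases hcd with h' | h' <;> exact h' (by linarith)

/-! ### Minimal vectors of a reduced basis -/

lemma one_le_sq_sub_abs_add_sq {s t : ℤ} (h : s ≠ 0 ∨ t ≠ 0) :
    1 ≤ s ^ 2 - |s * t| + t ^ 2 := by
  have : 0 < s ^ 2 + t ^ 2 := by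
    rcases h with h | h
    · have := sq_pos_iff.2 h; positivity
    · have := sq_pos_iff.2 h; positivity
  have h1 : 2 * |s * t| ≤ s ^ 2 + t ^ 2 := by
    rw [abs_mul, ← sq_abs s, ← sq_abs t]
    nlinarith [sq_nonneg (|s| - |t|)]
  by_contra hcon
  have : |s * t| ≤ 0 := by nlinarith
  nlinarith

/-- A lower bound for a reduced binary quadratic form with its slack terms. -/
lemma reduced_form_lower_bound {A B C : ℝ} (hA : 0 < A) (hB : 0 ≤ B)
    {s t : ℤ} (h : s ≠ 0 ∨ t ≠ 0) :
    A + (C - A) * (t : ℝ) ^ 2 + (A - 2 * B) * |(s * t : ℝ)| ≤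
      A * (s : ℝ) ^ 2 + 2 * B * (s * t) + C * (t : ℝ) ^ 2 := by
  have h1 : (1 : ℝ) ≤ (s : ℝ) ^ 2 - |(s * t : ℝ)| + (t : ℝ) ^ 2 := by
    exact_mod_cast one_le_sq_sub_abs_add_sq h
  have h2 := mul_le_mul_of_nonneg_left h1 hA.le
  have h3 := mul_le_mul_of_nonneg_left (neg_abs_le (s * t : ℝ)) hB
  linarith

lemma ne_zero_or_ne_zero_of_ne_zero {c : Fin 2 → ℤ} (hc : c ≠ 0) : c 0 ≠ 0 ∨ c 1 ≠ 0 := by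
  by_contra! h
  exact hc (by ext i; fin_cases i <;> simp [h])

lemma gram_of_theta11_eq_zero {b : Fin 2 → Fin 2 → ℝ} (hb : 0 < gramDet b)
    (hA : 0 < nsq (b 0)) (hAC : nsq (b 0) ≤ nsq (b 1)) (hB : 0 ≤ ip (b 0) (b 1))
    (h2B : 2 * ip (b 0) (b 1) ≤ nsq (b 0)) (hθ : ∀ τ : ℂ, 0 < τ.im → theta11 b τ = 0) :
    nsq (b 1) = nsq (b 0) ∧ (ip (b 0) (b 1) = 0 ∨ ip (b 0) (b 1) = nsq (b 0) / 2) := by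
  have hm : ∀ c ≠ 0, nsq (b 0) ≤ nsq (LV b c) := fun c hc => by
    have := reduced_form_lower_bound (C := nsq (b 1)) hA hB (ne_zero_or_ne_zero_of_ne_zero hc)
    rw [nsq_LV]
    have := mul_nonneg (sub_nonneg.2 hAC) (sq_nonneg (c 1 : ℝ))
    have := mul_nonneg (sub_nonneg.2 h2B) (abs_nonneg (c 0 * c 1 : ℝ))
    linarith
  have hne : ∀ c, nsq (LV b c) = nsq (b 0) → c ≠ 0 := by
    rintro c h rfl
    simp [nsq_LV] at h
    exact hA.ne h
  have hsq : ∀ s : ℤ, nsq (b 0) * (s : ℝ) ^ 2 = nsq (b 0) → s = 1 ∨ s = -1 := fun s h => by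
    have : (s : ℝ) ^ 2 = 1 := by
      apply mul_left_cancel₀ hA.ne'; rw [h, mul_one]
    exact sq_eq_one_iff.1 (by exact_mod_cast this)
  have hEq : nsq (b 1) = nsq (b 0) := by
    by_contra hlt
    replace hlt := lt_of_le_of_ne hAC (Ne.symm hlt)
    have hF : ∀ c, c ∈ ({![1, 0], ![-1, 0]} : Finset (Fin 2 → ℤ)) ↔
        nsq (LV b c) = nsq (b 0) := by
      intro c
      constructor
      · intro h
        simp only [Finset.mem_insert, Finset.mem_singleton] at h
        rcases h with rfl | rfl <;> simp [nsq_LV]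
      · intro h
        have h1 := reduced_form_lower_bound (C := nsq (b 1)) hA hB
          (ne_zero_or_ne_zero_of_ne_zero (hne c h))
        rw [nsq_LV] at h
        have h2 := mul_nonneg (sub_nonneg.2 h2B) (abs_nonneg (c 0 * c 1 : ℝ))
        have h3 : c 1 = 0 := by
          by_contra h3
          have : 0 < (c 1 : ℝ) ^ 2 := sq_pos_iff.2 (Int.cast_ne_zero.2 h3)
          have := mul_pos (sub_pos.2 hlt) this
          linarith
        have h4 := hsq (c 0) (by simpa [h3] using h)
        have hc : c = ![c 0, c 1] := by ext i; fin_cases i <;> rfl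
        rw [hc, h3]
        rcases h4 with h4 | h4 <;> simp [h4]
    have := sum_minimal_eq_zero hb hm hθ hF
    rw [Finset.sum_pair (by decide), Finset.sum_pair (by decide), Finset.sum_pair (by decide)]
      at this
    simp [ip_LV, nsq_LV] at this
    nlinarith [mul_pos hA hA]
  refine ⟨hEq, ?_⟩
  by_contra! hcon
  obtain ⟨hB0, hBh⟩ := hcon
  have hlt : 2 * ip (b 0) (b 1) < nsq (b 0) :=
    lt_of_le_of_ne h2B fun h => hBh (by linarith)
  have hF : ∀ c, c ∈ ({![1, 0], ![-1, 0], ![0, 1], ![0, -1]} : Finset (Fin 2 → ℤ)) ↔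
      nsq (LV b c) = nsq (b 0) := by
    intro c
    constructor
    · intro h
      simp only [Finset.mem_insert, Finset.mem_singleton] at h
      rcases h with rfl | rfl | rfl | rfl <;> simp [nsq_LV, hEq]
    · intro h
      have h1 := reduced_form_lower_bound (C := nsq (b 1)) hA hB
        (ne_zero_or_ne_zero_of_ne_zero (hne c h))
      rw [nsq_LV] at h
      have h2 := mul_nonneg (sub_nonneg.2 hAC) (sq_nonneg (c 1 : ℝ))
      have h3 : c 0 = 0 ∨ c 1 = 0 := by
        by_contra! h3
        have : 0 < |(c 0 * c 1 : ℝ)| :=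
          abs_pos.2 (mul_ne_zero (Int.cast_ne_zero.2 h3.1) (Int.cast_ne_zero.2 h3.2))
        have := mul_pos (sub_pos.2 hlt) this
        linarith
      have hc : c = ![c 0, c 1] := by ext i; fin_cases i <;> rfl
      rcases h3 with h3 | h3
      · have h4 := hsq (c 1) (by simpa [h3, hEq] using h)
        rw [hc, h3]
        rcases h4 with h4 | h4 <;> simp [h4]
      · have h4 := hsq (c 0) (by simpa [h3] using h)
        rw [hc, h3]
        rcases h4 with h4 | h4 <;> simp [h4]
  have := sum_minimal_eq_zero hb hm hθ hF
  simp only [Finset.sum_insert (show (![1, 0] : Fin 2 → ℤ) ∉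
      ({![-1, 0], ![0, 1], ![0, -1]} : Finset (Fin 2 → ℤ)) by decide),
    Finset.sum_insert (show (![-1, 0] : Fin 2 → ℤ) ∉
      ({![0, 1], ![0, -1]} : Finset (Fin 2 → ℤ)) by decide),
    Finset.sum_insert (show (![0, 1] : Fin 2 → ℤ) ∉
      ({![0, -1]} : Finset (Fin 2 → ℤ)) by decide), Finset.sum_singleton] at this
  simp [ip_LV, nsq_LV, hEq] at this
  have h0 : ip (b 0) (b 1) ^ 2 = 0 := by linarith
  exact hB0 (pow_eq_zero_iff two_ne_zero |>.1 h0)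

/-! ### Similarities -/

lemma image_latticeSet (M : Matrix (Fin 2) (Fin 2) ℝ) (c : ℝ) (b : Fin 2 → Fin 2 → ℝ) :
    (fun x => M.mulVec (c • x)) '' latticeSet b =
      latticeSet fun i => M.mulVec (c • b i) := by
  have h : ∀ s, M.mulVec (c • LV b s) = LV (fun i => M.mulVec (c • b i)) s := fun s => by
    simp only [LV, Fin.sum_univ_two, smul_add, Matrix.mulVec_add, Matrix.mulVec_smul,
      smul_comm c]
  ext x
  constructor
  · rintro ⟨_, ⟨s, rfl⟩, rfl⟩
    exact ⟨s, h s⟩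
  · rintro ⟨s, rfl⟩
    exact ⟨_, ⟨s, rfl⟩, h s⟩

lemma squareLattice_eq : squareLattice = latticeSet ![![1, 0], ![0, 1]] := by
  ext x
  refine exists_congr fun c => ?_
  have : LV ![![1, 0], ![0, 1]] c = fun i => (c i : ℝ) := by
    ext i; fin_cases i <;> simp [LV]
  rw [this]

lemma hexLattice_eq : hexLattice = latticeSet ![![1, 0], ![1 / 2, Real.sqrt 3 / 2]] := by
  ext x
  refine exists_congr fun c => ?_
  simp only [LV, Fin.sum_univ_two, Matrix.cons_val_zero, Matrix.cons_val_one]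

lemma ip_mulVec_transpose {M : Matrix (Fin 2) (Fin 2) ℝ}
    (hM : M ∈ Matrix.orthogonalGroup (Fin 2) ℝ) (c : ℝ) (v w : Fin 2 → ℝ) :
    ip (M.transpose.mulVec (c • v)) (M.transpose.mulVec (c • w)) = c ^ 2 * ip v w := by
  have h : ∀ v w : Fin 2 → ℝ, ip v w = v ⬝ᵥ w := fun _ _ => rfl
  have h1 : M * M.transpose = 1 := (Matrix.mem_orthogonalGroup_iff _ _).1 hM
  rw [h, h, Matrix.dotProduct_mulVec, Matrix.vecMul_transpose, Matrix.mulVec_mulVec, h1,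
    Matrix.one_mulVec, smul_dotProduct, dotProduct_smul, smul_eq_mul, smul_eq_mul]
  ring

lemma exists_gram_of_image_eq {b e : Fin 2 → Fin 2 → ℝ} {c : ℝ} (hc : 0 < c)
    {M : Matrix (Fin 2) (Fin 2) ℝ} (hM : M ∈ Matrix.orthogonalGroup (Fin 2) ℝ)
    (h : (fun x => M.mulVec (c • x)) '' latticeSet b = latticeSet e) :
    ∃ b' : Fin 2 → Fin 2 → ℝ, latticeSet b = latticeSet b' ∧
      ∀ i j, ip (b' i) (b' j) = c⁻¹ ^ 2 * ip (e i) (e j) := by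
  refine ⟨fun i => M.transpose.mulVec (c⁻¹ • e i), ?_, fun i j => ip_mulVec_transpose hM _ _ _⟩
  rw [← image_latticeSet, ← h, Set.image_image]
  have h1 : M.transpose * M = 1 := (Matrix.mem_orthogonalGroup_iff' _ _).1 hM
  have : ∀ x : Fin 2 → ℝ, M.transpose.mulVec (c⁻¹ • M.mulVec (c • x)) = x := fun x => by
    rw [Matrix.mulVec_smul, Matrix.mulVec_smul, Matrix.mulVec_smul, smul_smul,
      inv_mul_cancel₀ hc.ne', one_smul, Matrix.mulVec_mulVec, h1, Matrix.one_mulVec]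
  simp only [this, Set.image_id']

lemma theta11_eq_zero_of_image_eq {b e : Fin 2 → Fin 2 → ℝ} (hb : 0 < gramDet b)
    {c : ℝ} (hc : 0 < c) {M : Matrix (Fin 2) (Fin 2) ℝ}
    (hM : M ∈ Matrix.orthogonalGroup (Fin 2) ℝ)
    (h : (fun x => M.mulVec (c • x)) '' latticeSet b = latticeSet e)
    (h0 : nsq (e 0) = 1) (h1 : nsq (e 1) = 1)
    (h2 : ip (e 0) (e 1) = 0 ∨ ip (e 0) (e 1) = 1 / 2) (τ : ℂ) : theta11 b τ = 0 := by
  obtain ⟨b', hl, hg⟩ := exists_gram_of_image_eq hc hM h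
  have g0 : nsq (b' 0) = c⁻¹ ^ 2 := by rw [nsq_eq_ip, hg, ← nsq_eq_ip, h0, mul_one]
  have g1 : nsq (b' 1) = c⁻¹ ^ 2 := by rw [nsq_eq_ip, hg, ← nsq_eq_ip, h1, mul_one]
  have hc2 : 0 < c⁻¹ ^ 2 := by positivity
  have hb' : 0 < gramDet b' := by
    rw [gramDet, g0, g1, hg]
    rcases h2 with h2 | h2 <;> rw [h2] <;> nlinarith [mul_pos hc2 hc2]
  rw [theta11_congr hb hb' hl]
  rcases h2 with h2 | h2
  · exact theta11_eq_zero_of_gram_square (g1.trans g0.symm) (by rw [hg, h2, mul_zero]) τ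
  · exact theta11_eq_zero_of_gram_hexagonal (g1.trans g0.symm) (by rw [hg, h2, g0]; ring) τ

lemma mem_orthogonalGroup_of_rows {v w : Fin 2 → ℝ} (hv : nsq v = 1) (hw : nsq w = 1)
    (h : ip v w = 0) : Matrix.of ![v, w] ∈ Matrix.orthogonalGroup (Fin 2) ℝ := by
  rw [Matrix.mem_orthogonalGroup_iff]
  simp only [nsq, ip, Fin.sum_univ_two] at hv hw h
  ext i j
  fin_cases i <;> fin_cases j <;>
    simp [Matrix.mul_apply, Fin.sum_univ_two, Matrix.transpose_apply] <;>
    linarith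

lemma exists_image_eq_square {b : Fin 2 → Fin 2 → ℝ} (hA : 0 < nsq (b 0))
    (h1 : nsq (b 1) = nsq (b 0)) (h2 : ip (b 0) (b 1) = 0) :
    ∃ c : ℝ, 0 < c ∧ ∃ M ∈ Matrix.orthogonalGroup (Fin 2) ℝ,
      (fun x => M.mulVec (c • x)) '' latticeSet b = squareLattice := by
  obtain ⟨c, hc, hcA⟩ : ∃ c : ℝ, 0 < c ∧ c ^ 2 * nsq (b 0) = 1 :=
    ⟨(Real.sqrt (nsq (b 0)))⁻¹, by positivity, by
      rw [inv_pow, Real.sq_sqrt hA.le, inv_mul_cancel₀ hA.ne']⟩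
  refine ⟨c, hc, Matrix.of ![c • b 0, c • b 1], mem_orthogonalGroup_of_rows ?_ ?_ ?_, ?_⟩
  · rw [← hcA]; simp [nsq]; ring
  · rw [← hcA, ← h1]; simp [nsq]; ring
  · rw [← mul_zero (c ^ 2), ← h2]; simp [ip]; ring
  · rw [image_latticeSet, squareLattice_eq]
    rw [h1.symm] at hcA
    have hcA' := hcA
    rw [h1] at hcA'
    simp only [nsq, ip, Fin.sum_univ_two] at hcA hcA' h2
    congr 1
    ext i j
    fin_cases i <;> fin_cases j <;> simp [Matrix.mulVec, dotProduct, Fin.sum_univ_two]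
    · linear_combination hcA'
    · linear_combination c ^ 2 * h2
    · linear_combination c ^ 2 * h2
    · linear_combination hcA

lemma exists_image_eq_hex {b : Fin 2 → Fin 2 → ℝ} (hA : 0 < nsq (b 0))
    (h1 : nsq (b 1) = nsq (b 0)) (h2 : ip (b 0) (b 1) = nsq (b 0) / 2) :
    ∃ c : ℝ, 0 < c ∧ ∃ M ∈ Matrix.orthogonalGroup (Fin 2) ℝ,
      (fun x => M.mulVec (c • x)) '' latticeSet b = hexLattice := by
  obtain ⟨c, hc, hcA⟩ : ∃ c : ℝ, 0 < c ∧ c ^ 2 * nsq (b 0) = 1 :=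
    ⟨(Real.sqrt (nsq (b 0)))⁻¹, by positivity, by
      rw [inv_pow, Real.sq_sqrt hA.le, inv_mul_cancel₀ hA.ne']⟩
  obtain ⟨r, hr, hr3⟩ : ∃ r : ℝ, r ^ 2 = 1 / 3 ∧ Real.sqrt 3 = 3 * r := by
    have h3 : Real.sqrt 3 ^ 2 = 3 := Real.sq_sqrt (by norm_num)
    exact ⟨Real.sqrt 3 / 3, by rw [div_pow, h3]; norm_num, by ring⟩
  have hcB : c ^ 2 * nsq (b 1) = 1 := by rw [h1, hcA]
  have hcI : c ^ 2 * ip (b 0) (b 1) = 1 / 2 := by rw [h2]; linarith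
  simp only [nsq, ip, Fin.sum_univ_two] at hcA hcB hcI
  refine ⟨c, hc, Matrix.of ![c • b 0, (c * r) • ((2 : ℝ) • b 1 - b 0)],
    mem_orthogonalGroup_of_rows ?_ ?_ ?_, ?_⟩
  · simp [nsq]; linear_combination hcA
  · simp [nsq]; linear_combination r ^ 2 * (4 * hcB - 4 * hcI + hcA) + 3 * hr
  · simp [ip]; linear_combination r * (2 * hcI - hcA)
  · rw [image_latticeSet, hexLattice_eq, hr3]
    congr 1
    ext i j
    fin_cases i <;> fin_cases j <;> simp [Matrix.mulVec, dotProduct, Fin.sum_univ_two]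
    · linear_combination hcA
    · linear_combination r * (2 * hcI - hcA)
    · linear_combination hcI
    · linear_combination r * (2 * hcB - hcI)

/-- Let `Λ ⊂ ℝ²` be a lattice.  Then `Θ_{1,1;Λ}` vanishes identically on the upper half
plane if and only if there are `c > 0` and `φ ∈ O(2)` such that `φ(c·Λ)` is the square
lattice `ℤ²` or the hexagonal lattice. -/
theorem theta11_eq_zero_iff_square_or_hexagonal
    (b : Fin 2 → Fin 2 → ℝ) (hb : LinearIndependent ℝ b)
    (Λ : Set (Fin 2 → ℝ)) (hΛ : Λ = {x | ∃ c : Fin 2 → ℤ, x = LV b c}) :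
    (∀ τ : ℂ, 0 < τ.im →
      ∑' cd : (Fin 2 → ℤ) × (Fin 2 → ℤ),
        (((ip (LV b cd.1) (LV b cd.2)) ^ 2
            - (1 / 2 : ℝ) * nsq (LV b cd.1) * nsq (LV b cd.2) : ℝ) : ℂ) *
          eq2 (nsq (LV b cd.1) + nsq (LV b cd.2)) τ = 0)
    ↔ ∃ c : ℝ, 0 < c ∧ ∃ M : Matrix (Fin 2) (Fin 2) ℝ,
        M ∈ Matrix.orthogonalGroup (Fin 2) ℝ ∧
        ((fun x => M.mulVec (c • x)) '' Λ = squareLattice ∨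
         (fun x => M.mulVec (c • x)) '' Λ = hexLattice) := by
  have hG := gramDet_pos_of_linearIndependent hb
  change Λ = latticeSet b at hΛ
  change (∀ τ : ℂ, 0 < τ.im → theta11 b τ = 0) ↔ _
  rw [hΛ]
  constructor
  · intro hθ
    obtain ⟨b', hG', hl, hA, hAC, hB, h2B⟩ := exists_reduced_basis hG
    have hθ' : ∀ τ : ℂ, 0 < τ.im → theta11 b' τ = 0 := fun τ hτ => by
      rw [theta11_congr hG' hG hl, hθ τ hτ]
    obtain ⟨h1, h2 | h2⟩ := gram_of_theta11_eq_zero hG' hA hAC hB h2B hθ'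
    · obtain ⟨c, hc, M, hM, h⟩ := exists_image_eq_square hA h1 h2
      exact ⟨c, hc, M, hM, Or.inl (hl ▸ h)⟩
    · obtain ⟨c, hc, M, hM, h⟩ := exists_image_eq_hex hA h1 h2
      exact ⟨c, hc, M, hM, Or.inr (hl ▸ h)⟩
  · rintro ⟨c, hc, M, hM, h | h⟩ τ -
    · rw [squareLattice_eq] at h
      exact theta11_eq_zero_of_image_eq hG hc hM h (by simp [nsq]) (by simp [nsq])
        (Or.inl (by simp [ip])) τ
    · rw [hexLattice_eq] at h
      refine theta11_eq_zero_of_image_eq hG hc hM h (by simp [nsq]) ?_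
        (Or.inr (by simp [ip])) τ
      have h3 : Real.sqrt 3 ^ 2 = 3 := Real.sq_sqrt (by norm_num)
      simp only [nsq, Fin.sum_univ_two, Matrix.cons_val_zero, Matrix.cons_val_one, div_pow, h3]
      norm_num
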